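/- arXiv:1108.5554 — 7 statements merged into one kernel-verified Lean document; each statement's English description precedes it below -/
import Mathlib

section
/- There exists an absolute constant C > 0 such that for all 0 < r < R and all μ > 0, the stationary-phase integral at z = 0 satisfies ∫_{B_{r/2,2R}} (1 + μ ξ₂² / |ξ|⁴)^{−1} dξ ≤ C R³ μ^{−1/2}, where B_{r/2,2R} = {ξ ∈ ℝ² : |ξ₁| ≥ r/2 and |ξ| ≤ 2R}. -/
/- STATEMENT 2:
There is an absolute constant C > 0 such that for all 0 < r < R and all μ > 0,
∫_{B_{r/2,2R}} (1 + μ ξ₂² / |ξ|⁴)^{−1} dξ ≤ C R³ μ^{−1/2},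
where B_{r/2,2R} = {ξ ∈ ℝ² : |ξ₁| ≥ r/2 and |ξ| ≤ 2R}. -/

open MeasureTheory Real
open scoped ENNReal

noncomputable section

abbrev E2 := EuclideanSpace ℝ (Fin 2)

theorem integrable_inv_one_add_mul_sq {a : ℝ} (ha : 0 < a) :
    Integrable fun x : ℝ => (1 + (a * x) ^ 2)⁻¹ :=
  integrable_inv_one_add_sq.comp_mul_left' ha.ne'

theorem integral_inv_one_add_mul_sq {a : ℝ} (ha : 0 < a) :
    ∫ x : ℝ, (1 + (a * x) ^ 2)⁻¹ = π / a := by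
  rw [Measure.integral_comp_mul_left (fun x : ℝ => (1 + x ^ 2)⁻¹) a,
    integral_univ_inv_one_add_sq, abs_of_pos (inv_pos.mpr ha), smul_eq_mul]
  field_simp

/-- Fubini for products of functions of the two coordinates of the Euclidean plane. -/
theorem integral_mul_coord_E2 (f g : ℝ → ℝ) :
    ∫ ξ : E2, f (ξ 0) * g (ξ 1) = (∫ x, f x) * ∫ y, g y := by
  have h := (EuclideanSpace.volume_preserving_symm_measurableEquiv_toLp (Fin 2)).integral_comp'
    (fun x : Fin 2 → ℝ => f (x 0) * g (x 1))
  have h' := integral_fintype_prod_volume_eq_prod (ι := Fin 2) (E := fun _ => ℝ) ![f, g]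
  simp only [Fin.prod_univ_two] at h'
  exact h.trans h'

theorem integrable_mul_coord_E2 {f g : ℝ → ℝ} (hf : Integrable f) (hg : Integrable g) :
    Integrable fun ξ : E2 => f (ξ 0) * g (ξ 1) := by
  have h' : Integrable fun x : Fin 2 → ℝ => f (x 0) * g (x 1) := by
    have := Integrable.fintype_prod (ι := Fin 2) (E := ℝ) (f := ![f, g])
      (μ := fun _ => volume) (by intro i; fin_cases i <;> assumption)
    simp only [Fin.prod_univ_two] at this
    exact this
  exact (EuclideanSpace.volume_preserving_symm_measurableEquiv_toLp (Fin 2)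
    ).integrable_comp_of_integrable h'

theorem stationary_phase_integral_z_zero :
    ∃ C > 0, ∀ r R μ : ℝ, 0 < r → r < R → 0 < μ →
      (∫ ξ in {ξ : E2 | r / 2 ≤ |ξ 0| ∧ ‖ξ‖ ≤ 2 * R},
          (1 + μ * (ξ 1) ^ 2 / ‖ξ‖ ^ 4)⁻¹) ≤ C * R ^ 3 * μ ^ (-(1/2 : ℝ)) := by
  refine ⟨16 * π, by positivity, fun r R μ hr hrR hμ => ?_⟩
  have hR : 0 < R := hr.trans hrR
  have hsμ : 0 < √μ := Real.sqrt_pos.mpr hμ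
  set a : ℝ := √μ / (4 * R ^ 2) with ha_def
  have ha : 0 < a := by positivity
  have hmeas : MeasurableSet {ξ : E2 | r / 2 ≤ |ξ 0| ∧ ‖ξ‖ ≤ 2 * R} := by
    refine IsClosed.measurableSet (IsClosed.and ?_ ?_)
    · exact isClosed_le (by fun_prop) (by fun_prop)
    · exact isClosed_le (by fun_prop) (by fun_prop)
  let f : ℝ → ℝ := (Set.Icc (-(2 * R)) (2 * R)).indicator fun _ => 1
  let g : ℝ → ℝ := fun y => (1 + (a * y) ^ 2)⁻¹
  have hf0 : ∀ x, 0 ≤ f x := Set.indicator_nonneg fun _ _ => zero_le_one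
  have hf : Integrable f :=
    (integrable_indicator_iff measurableSet_Icc).mpr
      (integrableOn_const measure_Icc_lt_top.ne)
  have hf_int : ∫ x, f x = 4 * R := by
    rw [integral_indicator measurableSet_Icc, setIntegral_const, Real.volume_real_Icc,
      max_eq_left (by linarith), smul_eq_mul]
    ring
  have hpow : μ ^ (-(1 / 2 : ℝ)) = (√μ)⁻¹ := by
    rw [Real.rpow_neg hμ.le, Real.sqrt_eq_rpow]
  have hle : ∀ ξ : E2, {ξ : E2 | r / 2 ≤ |ξ 0| ∧ ‖ξ‖ ≤ 2 * R}.indicator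
      (fun ξ => (1 + μ * (ξ 1) ^ 2 / ‖ξ‖ ^ 4)⁻¹) ξ ≤ f (ξ 0) * g (ξ 1) := by
    intro ξ
    refine Set.indicator_apply_le' (fun hξ => ?_) fun _ => mul_nonneg (hf0 _) (by positivity)
    obtain ⟨h0, hn⟩ := hξ
    have hcoord : |ξ 0| ≤ ‖ξ‖ := by simpa using PiLp.norm_apply_le ξ 0
    have hpos : 0 < ‖ξ‖ := by linarith
    have hmem : ξ 0 ∈ Set.Icc (-(2 * R)) (2 * R) := abs_le.mp (hcoord.trans hn)
    have hf1 : f (ξ 0) = 1 := Set.indicator_of_mem hmem _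
    rw [hf1, one_mul]
    have hsq : (a * ξ 1) ^ 2 = μ * (ξ 1) ^ 2 / (2 * R) ^ 4 := by
      rw [ha_def, mul_pow, div_pow, Real.sq_sqrt hμ.le]
      ring
    change _ ≤ (1 + (a * ξ 1) ^ 2)⁻¹
    rw [hsq]
    gcongr
  calc _ = ∫ ξ : E2, {ξ : E2 | r / 2 ≤ |ξ 0| ∧ ‖ξ‖ ≤ 2 * R}.indicator
        (fun ξ => (1 + μ * (ξ 1) ^ 2 / ‖ξ‖ ^ 4)⁻¹) ξ := (integral_indicator hmeas).symm
    _ ≤ ∫ ξ : E2, f (ξ 0) * g (ξ 1) :=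
        integral_mono_of_nonneg
          (.of_forall <| Set.indicator_nonneg fun _ _ => by positivity)
          (integrable_mul_coord_E2 hf (integrable_inv_one_add_mul_sq ha)) (.of_forall hle)
    _ = 4 * R * (π / a) := by
        rw [integral_mul_coord_E2, hf_int, integral_inv_one_add_mul_sq ha]
    _ = 16 * π * R ^ 3 * μ ^ (-(1 / 2 : ℝ)) := by
        rw [hpow, ha_def]
        field_simp
        ring

end
end

section
/- There exists an absolute constant C > 0 such that for all 0 < r < R and all μ > 0, H̃(μ, 0) ≤ C R^{5/2} r^{−1} μ^{−1/2}. -/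
/- STATEMENT 4:
There is an absolute constant C > 0 such that for all 0 < r < R and μ > 0,
H̃(μ,0) ≤ C R^{5/2} r^{−1} μ^{−1/2}. -/

open Real

/-- The quantity
`H̃(μ,φ) = ∫₀^{2R} ∫_{r/2}^{2R} (1 + μ ξ₂² (ξ₁ cos φ − ξ₂ sin φ)² / (8R³))⁻¹ dξ₁ dξ₂`. -/
noncomputable def Htilde (r R μ φ : ℝ) : ℝ :=
  ∫ ξ₂ in (0:ℝ)..(2 * R), ∫ ξ₁ in (r / 2)..(2 * R),
    (1 + μ * ξ₂ ^ 2 * (ξ₁ * Real.cos φ - ξ₂ * Real.sin φ) ^ 2 / (8 * R ^ 3))⁻¹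

open intervalIntegral in
/-- The integral of a dilated Cauchy kernel over `[0, b]` is at most half of its total mass. -/
lemma integral_inv_one_add_mul_sq_le {k : ℝ} (hk : 0 < k) (b : ℝ) :
    ∫ x in (0:ℝ)..b, (1 + (k * x) ^ 2)⁻¹ ≤ k⁻¹ * (π / 2) := by
  rw [integral_comp_mul_left (fun x => (1 + x ^ 2)⁻¹) hk.ne', integral_inv_one_add_sq,
    mul_zero, Real.arctan_zero, sub_zero, smul_eq_mul]
  gcongr
  exact (Real.arctan_lt_pi_div_two _).le

/-- At `φ = 0` the inner integrand is largest at `ξ₁ = r / 2`. -/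
lemma inner_integral_le {r R μ : ℝ} (hr : 0 < r) (hrR : r < R) (hμ : 0 < μ) (y : ℝ) :
    ∫ x in (r / 2)..(2 * R), (1 + μ * y ^ 2 * x ^ 2 / (8 * R ^ 3))⁻¹ ≤
      2 * R * (1 + μ * y ^ 2 * (r / 2) ^ 2 / (8 * R ^ 3))⁻¹ := by
  have hR : 0 < R := hr.trans hrR
  have hpos : ∀ x : ℝ, 0 < 1 + μ * y ^ 2 * x ^ 2 / (8 * R ^ 3) := fun x => by positivity
  calc ∫ x in (r / 2)..(2 * R), (1 + μ * y ^ 2 * x ^ 2 / (8 * R ^ 3))⁻¹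
      ≤ ∫ _ in (r / 2)..(2 * R), (1 + μ * y ^ 2 * (r / 2) ^ 2 / (8 * R ^ 3))⁻¹ := by
        refine intervalIntegral.integral_mono_on (by linarith) ?_ (by simp) fun x hx => ?_
        · exact (Continuous.inv₀ (by fun_prop) fun x => (hpos x).ne').intervalIntegrable _ _
        · have := hx.1
          gcongr
    _ ≤ _ := by
        rw [intervalIntegral.integral_const, smul_eq_mul]
        have := hpos (r / 2)
        gcongr
        linarith

theorem Htilde_phi_zero_bound :
    ∃ C > 0, ∀ r R μ : ℝ, 0 < r → r < R → 0 < μ →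
      Htilde r R μ 0 ≤ C * R ^ ((5:ℝ)/2) * r⁻¹ * μ ^ (-(1/2 : ℝ)) := by
  refine ⟨π * √32, by positivity, fun r R μ hr hrR hμ => ?_⟩
  have hR : 0 < R := hr.trans hrR
  set k : ℝ := r * μ ^ (1 / 2 : ℝ) / (√32 * R ^ (3 / 2 : ℝ)) with hk_def
  have hk : 0 < k := by positivity
  have hμ_sq : (μ ^ (1 / 2 : ℝ)) ^ 2 = μ := by
    rw [← Real.rpow_mul_natCast hμ.le]; norm_num
  have hR_sq : (R ^ (3 / 2 : ℝ)) ^ 2 = R ^ 3 := by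
    rw [← Real.rpow_mul_natCast hR.le, ← Real.rpow_natCast]; norm_num
  have hk_sq : k ^ 2 = r ^ 2 * μ / (32 * R ^ 3) := by
    rw [hk_def, div_pow, mul_pow, mul_pow, hμ_sq, hR_sq, Real.sq_sqrt (by norm_num)]
  have hkernel : ∀ y : ℝ, μ * y ^ 2 * (r / 2) ^ 2 / (8 * R ^ 3) = (k * y) ^ 2 := fun y => by
    rw [mul_pow, hk_sq]; field_simp; ring
  have hR_pow : R ^ (5 / 2 : ℝ) = R * R ^ (3 / 2 : ℝ) := by
    rw [← Real.rpow_one_add' hR.le (by norm_num)]; norm_num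
  calc Htilde r R μ 0
      = ∫ y in (0:ℝ)..(2 * R), ∫ x in (r / 2)..(2 * R),
          (1 + μ * y ^ 2 * x ^ 2 / (8 * R ^ 3))⁻¹ := by simp [Htilde]
    _ ≤ ∫ y in (0:ℝ)..(2 * R), 2 * R * (1 + (k * y) ^ 2)⁻¹ := by
        refine intervalIntegral.integral_mono_on (by positivity) ?_ ?_ fun y _ => ?_
        · refine Continuous.intervalIntegrable ?_ _ _
          refine intervalIntegral.continuous_parametric_intervalIntegral_of_continuous' ?_ _ _
          refine Continuous.inv₀ (by fun_prop) fun p => ?_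
          positivity
        · refine Continuous.intervalIntegrable ?_ _ _
          refine continuous_const.mul (Continuous.inv₀ (by fun_prop) fun y => ?_)
          positivity
        · rw [← hkernel]
          exact inner_integral_le hr hrR hμ y
    _ ≤ 2 * R * (k⁻¹ * (π / 2)) := by
        rw [intervalIntegral.integral_const_mul]
        gcongr
        exact integral_inv_one_add_mul_sq_le hk _
    _ = π * √32 * R ^ ((5:ℝ)/2) * r⁻¹ * μ ^ (-(1/2 : ℝ)) := by
        rw [hR_pow, Real.rpow_neg hμ.le, hk_def]
        field_simp
end

section
/- There exists an absolute constant C > 0 such that for all 0 < r < R, all μ > 0, and all φ ∈ [arctan(r/(8R)), π/4], H̃(μ, φ) ≤ C R^{5/2} r^{−1} μ^{−1/2}. -/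
/- STATEMENT 6:
There is an absolute constant C > 0 such that for all 0 < r < R, μ > 0, and
φ ∈ [arctan(r/(8R)), π/4], H̃(μ,φ) ≤ C R^{5/2} r^{−1} μ^{−1/2}. -/

open Real

/-- A rescaled Cauchy kernel `(1 + (B * y - e)²)⁻¹` has mass at most `π / B` on every interval. -/
lemma integral_inv_one_add_mul_sub_sq_le {B : ℝ} (hB : 0 < B) (e a b : ℝ) :
    ∫ y in a..b, (1 + (B * y - e) ^ 2)⁻¹ ≤ π / B := by
  rw [intervalIntegral.integral_comp_mul_sub (fun y => (1 + y ^ 2)⁻¹) hB.ne', smul_eq_mul,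
    integral_inv_one_add_sq, inv_mul_eq_div]
  gcongr
  linarith [arctan_lt_pi_div_two (B * b - e), neg_pi_div_two_lt_arctan (B * a - e)]

/-- If `A ≤ x * c`, then one of `y * s` and `x * c - y * s` is at least `A / 2`, so the kernel
is dominated by the sum of two Cauchy kernels. -/
lemma inv_one_add_quartic_le {k s A x c y : ℝ} (hs : 0 < s) (hA : 0 < A)
    (hx : A ≤ x * c) (hk : 0 < k) :
    (1 + k ^ 2 * y ^ 2 * (x * c - y * s) ^ 2)⁻¹ ≤
      (1 + (k * A / 2 * y - 0) ^ 2)⁻¹ +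
        (1 + (k * A / 2 * y - k * A / 2 * (x * c / s)) ^ 2)⁻¹ := by
  rcases le_total (A / 2) (x * c - y * s) with h | h
  · refine le_add_of_le_of_nonneg ?_ (by positivity)
    have : (k * A / 2 * y - 0) ^ 2 = k ^ 2 * y ^ 2 * (A / 2) ^ 2 := by ring
    rw [this]
    gcongr
  · refine le_add_of_nonneg_of_le (by positivity) ?_
    have hys : A / 2 ≤ y * s := by linarith
    have : (k * A / 2 * y - k * A / 2 * (x * c / s)) ^ 2
        = k ^ 2 * (A / 2 / s) ^ 2 * (x * c - y * s) ^ 2 := by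
      field_simp
      ring
    rw [this]
    have : A / 2 / s ≤ y := by rwa [div_le_iff₀ hs]
    gcongr

lemma integral_inv_one_add_quartic_le {k s A x c L : ℝ} (hs : 0 < s) (hA : 0 < A)
    (hx : A ≤ x * c) (hk : 0 < k) (hL : 0 ≤ L) :
    ∫ y in (0 : ℝ)..L, (1 + k ^ 2 * y ^ 2 * (x * c - y * s) ^ 2)⁻¹ ≤ 4 * π / (k * A) := by
  have hB : 0 < k * A / 2 := by positivity
  have hcont (e : ℝ) : Continuous fun y : ℝ => (1 + (k * A / 2 * y - e) ^ 2)⁻¹ :=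
    Continuous.inv₀ (by fun_prop) fun y => by positivity
  have hcont' : Continuous fun y : ℝ => (1 + k ^ 2 * y ^ 2 * (x * c - y * s) ^ 2)⁻¹ :=
    Continuous.inv₀ (by fun_prop) fun y => by positivity
  calc _ ≤ ∫ y in (0 : ℝ)..L, ((1 + (k * A / 2 * y - 0) ^ 2)⁻¹ +
        (1 + (k * A / 2 * y - k * A / 2 * (x * c / s)) ^ 2)⁻¹) :=
        intervalIntegral.integral_mono_on hL (hcont'.intervalIntegrable _ _)
          (((hcont _).add (hcont _)).intervalIntegrable _ _)
          fun y _ => inv_one_add_quartic_le hs hA hx hk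
    _ ≤ π / (k * A / 2) + π / (k * A / 2) := by
        rw [intervalIntegral.integral_add ((hcont _).intervalIntegrable _ _)
          ((hcont _).intervalIntegrable _ _)]
        exact add_le_add (integral_inv_one_add_mul_sub_sq_le hB _ _ _)
          (integral_inv_one_add_mul_sub_sq_le hB _ _ _)
    _ = 4 * π / (k * A) := by
        field_simp
        ring

theorem Htilde_phi_middle_bound :
    ∃ C > 0, ∀ r R μ φ : ℝ, 0 < r → r < R → 0 < μ →
      φ ∈ Set.Icc (Real.arctan (r / (8 * R))) (π / 4) →
      Htilde r R μ φ ≤ C * R ^ ((5:ℝ)/2) * r⁻¹ * μ ^ (-(1/2 : ℝ)) := by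
  refine ⟨64 * π, by positivity, fun r R μ φ hr hrR hμ hφ => ?_⟩
  have hR : 0 < R := hr.trans hrR
  have hφ0 : 0 < φ := (arctan_pos.2 (by positivity)).trans_le hφ.1
  have hs : 0 < sin φ := sin_pos_of_pos_of_lt_pi hφ0 (by linarith [hφ.2, pi_pos])
  have hc : √2 / 2 ≤ cos φ := by
    rw [← cos_pi_div_four]
    exact cos_le_cos_of_nonneg_of_le_pi hφ0.le (by linarith [pi_pos]) hφ.2
  set k : ℝ := √(μ / (8 * R ^ 3)) with hk_def
  have hk : 0 < k := by positivity
  have hk2 : k ^ 2 = μ / (8 * R ^ 3) := sq_sqrt (by positivity)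
  have hcont : Continuous (Function.uncurry fun y x : ℝ =>
      (1 + k ^ 2 * y ^ 2 * (x * cos φ - y * sin φ) ^ 2)⁻¹) :=
    Continuous.inv₀ (by fun_prop) fun p => by positivity
  have hH : Htilde r R μ φ = ∫ x in (r / 2)..(2 * R), ∫ y in (0 : ℝ)..(2 * R),
      (1 + k ^ 2 * y ^ 2 * (x * cos φ - y * sin φ) ^ 2)⁻¹ := by
    rw [← MeasureTheory.intervalIntegral_intervalIntegral_swap
      ((hcont.continuousOn.integrableOn_compact (isCompact_uIcc.prod isCompact_uIcc)).mono_set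
        (Set.prod_mono Set.uIoc_subset_uIcc Set.uIoc_subset_uIcc))]
    simp only [Htilde, hk2]
    congr! 6
    ring
  have hA : 0 < r / 2 * (√2 / 2) := by positivity
  have hinner : ∀ x ∈ Set.uIoc (r / 2) (2 * R), ‖∫ y in (0 : ℝ)..(2 * R),
      (1 + k ^ 2 * y ^ 2 * (x * cos φ - y * sin φ) ^ 2)⁻¹‖
        ≤ 4 * π / (k * (r / 2 * (√2 / 2))) := by
    intro x hx
    rw [Set.uIoc_of_le (by linarith)] at hx
    rw [norm_of_nonneg (intervalIntegral.integral_nonneg (by positivity)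
      fun y _ => by positivity)]
    refine integral_inv_one_add_quartic_le hs hA ?_ hk (by positivity)
    have := hx.1.le
    have : 0 < x := by linarith [hx.1]
    gcongr
  have hk_eq : k * (2 * √2 * R ^ ((5 : ℝ) / 2)) = √μ * R := by
    have hR5 : (R ^ ((5 : ℝ) / 2)) ^ 2 = R ^ 5 := by
      rw [← rpow_mul_natCast hR.le]
      norm_num
    rw [← sq_eq_sq₀ (by positivity) (by positivity)]
    simp only [mul_pow, hk2, hR5, sq_sqrt hμ.le, sq_sqrt zero_le_two]
    field_simp
    norm_num
  rw [hH]
  refine (le_norm_self _).trans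
    ((intervalIntegral.norm_integral_le_of_norm_le_const hinner).trans ?_)
  rw [rpow_neg hμ.le, ← sqrt_eq_rpow, abs_of_nonneg (by linarith)]
  calc _ ≤ 4 * π / (k * (r / 2 * (√2 / 2))) * (2 * R) := by
        gcongr
        linarith
    _ = 64 * π * R ^ ((5 : ℝ) / 2) * r⁻¹ * (√μ)⁻¹ := by
        have hμ' : 0 < √μ := sqrt_pos.2 hμ
        field_simp
        linear_combination -32 * hk_eq
end

section
/- There exists an absolute constant C > 0 such that for all 0 < r < R and all μ > 0, H̃(μ, π/2) ≤ C R^{7/4} μ^{−1/4}. -/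
/- STATEMENT 7:
There is an absolute constant C > 0 such that for all 0 < r < R and μ > 0,
H̃(μ, π/2) ≤ C R^{7/4} μ^{−1/4}. -/

open Real

/-- The integral of `1 / (1 + (b x)⁴)` over `[0, L]` is at most `π / b`, uniformly in `L`. -/
lemma integral_inv_one_add_mul_pow_four_le {b L : ℝ} (hb : 0 < b) (hL : 0 ≤ L) :
    ∫ x in (0:ℝ)..L, (1 + (b * x) ^ 4)⁻¹ ≤ π * b⁻¹ := by
  have hcont4 : Continuous fun x : ℝ => (1 + (b * x) ^ 4)⁻¹ :=
    Continuous.inv₀ (by fun_prop) fun x => by positivity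
  have hcont2 : Continuous fun x : ℝ => 2 * (1 + (b * x) ^ 2)⁻¹ :=
    continuous_const.mul (Continuous.inv₀ (by fun_prop) fun x => by positivity)
  have hpt (t : ℝ) : (1 + t ^ 4)⁻¹ ≤ 2 * (1 + t ^ 2)⁻¹ := by
    rw [← div_eq_mul_inv, inv_eq_one_div, div_le_div_iff₀ (by positivity) (by positivity)]
    nlinarith [sq_nonneg (t ^ 2 - 1), sq_nonneg (t ^ 2)]
  calc ∫ x in (0:ℝ)..L, (1 + (b * x) ^ 4)⁻¹
      ≤ ∫ x in (0:ℝ)..L, 2 * (1 + (b * x) ^ 2)⁻¹ :=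
        intervalIntegral.integral_mono_on hL (hcont4.intervalIntegrable _ _)
          (hcont2.intervalIntegrable _ _) fun x _ => hpt (b * x)
    _ = 2 * arctan (b * L) * b⁻¹ := by
        rw [intervalIntegral.integral_const_mul,
          intervalIntegral.integral_comp_mul_left (fun y : ℝ => (1 + y ^ 2)⁻¹) hb.ne',
          integral_inv_one_add_sq]
        simp only [mul_zero, arctan_zero, sub_zero, smul_eq_mul]
        ring
    _ ≤ π * b⁻¹ := by
        gcongr
        linarith [arctan_lt_pi_div_two (b * L)]

/-- At `φ = π / 2` the inner integrand does not depend on `ξ₁`. -/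
lemma Htilde_pi_div_two (r R μ : ℝ) :
    Htilde r R μ (π / 2) =
      (2 * R - r / 2) * ∫ x in (0:ℝ)..(2 * R), (1 + μ / (8 * R ^ 3) * x ^ 4)⁻¹ := by
  rw [← intervalIntegral.integral_const_mul]
  simp only [Htilde, cos_pi_div_two, sin_pi_div_two, intervalIntegral.integral_const, smul_eq_mul,
    mul_zero, mul_one, zero_sub]
  congr! 4 with x
  ring

theorem Htilde_phi_pi_half_bound :
    ∃ C > 0, ∀ r R μ : ℝ, 0 < r → r < R → 0 < μ →
      Htilde r R μ (π / 2) ≤ C * R ^ ((7:ℝ)/4) * μ ^ (-(1/4 : ℝ)) := by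
  refine ⟨2 * π * 8 ^ (1/4 : ℝ), by positivity, fun r R μ hr hrR hμ => ?_⟩
  have hR : 0 < R := hr.trans hrR
  set b : ℝ := (μ / (8 * R ^ 3)) ^ (1/4 : ℝ) with hb
  have hb0 : 0 < b := by positivity
  have hb4 : b ^ 4 = μ / (8 * R ^ 3) := by
    rw [hb, ← rpow_natCast, ← rpow_mul (by positivity)]
    norm_num
  have hbinv : b⁻¹ = 8 ^ (1/4 : ℝ) * R ^ (3/4 : ℝ) * μ ^ (-(1/4 : ℝ)) := by
    rw [hb, div_rpow hμ.le (by positivity), mul_rpow (by norm_num) (by positivity),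
      ← rpow_natCast R 3, ← rpow_mul hR.le, rpow_neg hμ.le, inv_div, div_eq_mul_inv]
    norm_num
  have hR74 : R ^ ((7:ℝ)/4) = R * R ^ (3/4 : ℝ) := by
    rw [← rpow_one_add' hR.le (by norm_num)]
    norm_num
  have hint := integral_inv_one_add_mul_pow_four_le hb0 (by positivity : 0 ≤ 2 * R)
  simp only [mul_pow, hb4] at hint
  calc Htilde r R μ (π / 2)
      = (2 * R - r / 2) * ∫ x in (0:ℝ)..(2 * R), (1 + μ / (8 * R ^ 3) * x ^ 4)⁻¹ :=
        Htilde_pi_div_two r R μ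
    _ ≤ (2 * R - r / 2) * (π * b⁻¹) := by
        gcongr
        linarith
    _ ≤ 2 * R * (π * b⁻¹) := by
        gcongr
        linarith
    _ = 2 * π * 8 ^ (1/4 : ℝ) * R ^ ((7:ℝ)/4) * μ ^ (-(1/4 : ℝ)) := by
        rw [hbinv, hR74]
        ring
end

section
/- Let c₀ ∈ (0,1] be such that arctan(x²) ≤ x for all x ∈ (0, c₀]. For 0 < r < R and μ > 0, set φ₀ = max{ π/4, arctan( μ^{1/4} r / (8 c₀ R^{3/4}) ) }. Then there exists a constant C > 0, depending only on c₀, such that for every φ ∈ [φ₀, π/2), H̃(μ, φ) ≤ C R^{11/4} r^{−1} μ^{−1/4}. -/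
/- STATEMENT 8:
Let c₀ ∈ (0,1] satisfy arctan(x²) ≤ x for all x ∈ (0,c₀]. For 0 < r < R and μ > 0 set
φ₀ = max{π/4, arctan(μ^{1/4} r / (8 c₀ R^{3/4}))}. Then there is C > 0, depending only
on c₀, such that for every φ ∈ [φ₀, π/2), H̃(μ,φ) ≤ C R^{11/4} r^{−1} μ^{−1/4}. -/

open Real

/-- Away from the line `ξ₁ cos φ = ξ₂ sin φ`, the integrand of `Htilde` decays in `y = ξ₂`
on the scale `B`. -/
lemma Htilde_integrand_le {R a b B c s x y : ℝ} (hR : 0 < R) (ha : 0 < a) (hb : 0 < b)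
    (hbR : b ^ 4 = R ^ 3) (hB : 32 * b ≤ a * B) (hB0 : 0 < B) (hs : 0 < s) (hs2 : 1 / 2 ≤ s ^ 2)
    (hc : 0 ≤ c) (hcB : 4 * R * c ≤ s * B) (hx : x ≤ 2 * R) (hy : 0 ≤ y) :
    (1 + a ^ 4 * y ^ 2 * (x * c - y * s) ^ 2 / (8 * R ^ 3))⁻¹ ≤ 2 * (1 + (B⁻¹ * y) ^ 2)⁻¹ := by
  have key : (1 + (B⁻¹ * y) ^ 2) / 2 ≤
      1 + a ^ 4 * y ^ 2 * (x * c - y * s) ^ 2 / (8 * R ^ 3) := by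
    rcases le_total y B with h | h
    · have h1 : B⁻¹ * y ≤ 1 := by rw [inv_mul_le_iff₀ hB0]; linarith
      have h0 : 0 ≤ B⁻¹ * y := by positivity
      have h2 : (B⁻¹ * y) ^ 2 ≤ 1 := pow_le_one₀ h0 h1
      have h3 : 0 ≤ a ^ 4 * y ^ 2 * (x * c - y * s) ^ 2 / (8 * R ^ 3) := by positivity
      linarith
    · have h1 : y * s / 2 ≤ y * s - x * c := by nlinarith
      have h2 : y ^ 2 / 8 ≤ (x * c - y * s) ^ 2 := by
        have : (y * s / 2) ^ 2 ≤ (y * s - x * c) ^ 2 := pow_le_pow_left₀ (by positivity) h1 2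
        nlinarith [sq_nonneg y]
      have h3 : B⁻¹ * y ≤ a * y / (32 * b) := by
        rw [inv_mul_le_iff₀ hB0, mul_div_assoc', le_div_iff₀ (by positivity)]
        nlinarith
      have h4 : 1 ≤ B⁻¹ * y := by rw [le_inv_mul_iff₀ hB0]; linarith
      have h5 : (B⁻¹ * y) ^ 2 ≤ (a * y / (32 * b)) ^ 4 :=
        (pow_le_pow_right₀ h4 (by norm_num)).trans
          (pow_le_pow_left₀ (by positivity) h3 4)
      have h6 : (a * y / (32 * b)) ^ 4 ≤ a ^ 4 * y ^ 2 * (y ^ 2 / 8) / (8 * R ^ 3) := by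
        rw [← hbR, div_pow, div_le_div_iff₀ (by positivity) (by positivity)]
        have : 0 ≤ a ^ 4 * y ^ 4 * b ^ 4 := by positivity
        nlinarith
      have h7 : a ^ 4 * y ^ 2 * (y ^ 2 / 8) / (8 * R ^ 3) ≤
          a ^ 4 * y ^ 2 * (x * c - y * s) ^ 2 / (8 * R ^ 3) := by gcongr
      have h8 : 0 ≤ (B⁻¹ * y) ^ 2 := by positivity
      linarith
  calc _ ≤ ((1 + (B⁻¹ * y) ^ 2) / 2)⁻¹ := inv_anti₀ (by positivity) key
    _ = _ := by rw [inv_div, div_eq_mul_inv]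

lemma integral_two_mul_inv_one_add_sq_le {B : ℝ} (hB : 0 < B) (L : ℝ) :
    ∫ y in (0 : ℝ)..L, 2 * (1 + (B⁻¹ * y) ^ 2)⁻¹ ≤ π * B := by
  rw [intervalIntegral.integral_const_mul,
    intervalIntegral.integral_comp_mul_left (fun y => (1 + y ^ 2)⁻¹) (inv_ne_zero hB.ne'),
    integral_inv_one_add_sq]
  simp only [mul_zero, arctan_zero, sub_zero, inv_inv, smul_eq_mul]
  nlinarith [arctan_lt_pi_div_two (B⁻¹ * L)]

theorem Htilde_phi_large_bound
    (c₀ : ℝ) (hc₀ : c₀ ∈ Set.Ioc (0:ℝ) 1)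
    (hc₀' : ∀ x ∈ Set.Ioc (0:ℝ) c₀, Real.arctan (x ^ 2) ≤ x) :
    ∃ C > 0, ∀ r R μ φ : ℝ, 0 < r → r < R → 0 < μ →
      φ ∈ Set.Ico (max (π / 4)
            (Real.arctan (μ ^ ((1:ℝ)/4) * r / (8 * c₀ * R ^ ((3:ℝ)/4))))) (π / 2) →
      Htilde r R μ φ ≤ C * R ^ ((11:ℝ)/4) * r⁻¹ * μ ^ (-(1/4 : ℝ)) := by
  obtain ⟨hc0, hc1⟩ := hc₀
  refine ⟨64 * π, by positivity, fun r R μ φ hr hrR hμ hφ => ?_⟩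
  obtain ⟨hφ1, hφ2⟩ := hφ
  obtain ⟨hφ4, hφa⟩ := max_le_iff.1 hφ1
  have hR : 0 < R := hr.trans hrR
  have hpi := pi_pos
  have ha : 0 < μ ^ ((1:ℝ)/4) := by positivity
  have hb : 0 < R ^ ((3:ℝ)/4) := by positivity
  have haμ : (μ ^ ((1:ℝ)/4)) ^ 4 = μ := by
    rw [← rpow_natCast, ← rpow_mul hμ.le]; norm_num
  have hbR : (R ^ ((3:ℝ)/4)) ^ 4 = R ^ 3 := by
    rw [← rpow_natCast, ← rpow_mul hR.le, ← rpow_natCast]; norm_num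
  have hR11 : R ^ ((11:ℝ)/4) = R ^ 2 * R ^ ((3:ℝ)/4) := by
    rw [← rpow_natCast, ← rpow_add hR]; norm_num
  rw [rpow_neg hμ.le, hR11]
  set a := μ ^ ((1:ℝ)/4)
  set b := R ^ ((3:ℝ)/4)
  have hcos : 0 < cos φ := cos_pos_of_mem_Ioo ⟨by linarith, hφ2⟩
  have hsin : 0 < sin φ := sin_pos_of_pos_of_lt_pi (by linarith) (by linarith)
  have hsin2 : 1 / 2 ≤ sin φ ^ 2 := by
    have h : cos (2 * φ) ≤ 0 :=
      cos_nonpos_of_pi_div_two_le_of_le (by linarith) (by linarith)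
    rw [cos_two_mul'] at h
    linarith [sin_sq_add_cos_sq φ]
  have htan : a * r / (8 * c₀ * b) ≤ sin φ / cos φ := by
    rw [← tan_eq_sin_div_cos, ← tan_arctan (a * r / (8 * c₀ * b))]
    exact strictMonoOn_tan.monotoneOn (arctan_mem_Ioo _) ⟨by linarith, hφ2⟩ hφa
  rw [div_le_div_iff₀ (by positivity) hcos] at htan
  set B := 32 * R * b / (a * r) with hBdef
  have hB0 : 0 < B := by positivity
  have hB : 32 * b ≤ a * B := by
    have : a * B = 32 * b * (R / r) := by rw [hBdef]; field_simp
    rw [this]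
    exact le_mul_of_one_le_right (by positivity) ((one_le_div hr).2 hrR.le)
  have hcB : 4 * R * cos φ ≤ sin φ * B := by
    rw [hBdef, mul_div_assoc', le_div_iff₀ (by positivity)]
    have h1 : sin φ * (8 * c₀ * b) ≤ sin φ * (8 * 1 * b) := by gcongr
    nlinarith
  have hinner : ∀ y ∈ Set.Ioc 0 (2 * R), ‖∫ x in (r / 2)..(2 * R),
      (1 + μ * y ^ 2 * (x * cos φ - y * sin φ) ^ 2 / (8 * R ^ 3))⁻¹‖ ≤
        2 * R * (2 * (1 + (B⁻¹ * y) ^ 2)⁻¹) := by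
    intro y hy
    have h := intervalIntegral.norm_integral_le_of_norm_le_const (a := r / 2) (b := 2 * R)
      (f := fun x => (1 + μ * y ^ 2 * (x * cos φ - y * sin φ) ^ 2 / (8 * R ^ 3))⁻¹)
      (C := 2 * (1 + (B⁻¹ * y) ^ 2)⁻¹) (fun x hx => by
        rw [Set.uIoc_of_le (by linarith)] at hx
        rw [norm_of_nonneg (by positivity), ← haμ]
        exact Htilde_integrand_le hR ha hb hbR hB hB0 hsin hsin2 hcos.le hcB hx.2 hy.1.le)
    rw [abs_of_pos (by linarith)] at h
    refine h.trans ?_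
    rw [mul_comm]
    gcongr
    linarith
  have hcont : Continuous fun y : ℝ => 2 * R * (2 * (1 + (B⁻¹ * y) ^ 2)⁻¹) := by
    refine continuous_const.mul (continuous_const.mul (Continuous.inv₀ (by fun_prop) ?_))
    intro y
    positivity
  calc Htilde r R μ φ ≤ ‖Htilde r R μ φ‖ := le_norm_self _
    _ ≤ ∫ y in (0 : ℝ)..(2 * R), 2 * R * (2 * (1 + (B⁻¹ * y) ^ 2)⁻¹) :=
        intervalIntegral.norm_integral_le_of_norm_le (by linarith)
          (Filter.Eventually.of_forall hinner) (hcont.intervalIntegrable _ _)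
    _ ≤ 2 * R * (π * B) := by
        rw [intervalIntegral.integral_const_mul]
        gcongr
        exact integral_two_mul_inv_one_add_sq_le hB0 _
    _ = 64 * π * (R ^ 2 * b) * r⁻¹ * a⁻¹ := by
        rw [hBdef]; field_simp; norm_num
end

section
/- Let c₀ ∈ (0,1] be such that arctan(x²) ≤ x for all x ∈ (0, c₀]. For 0 < r < R and μ > 0, set φ₀ = max{ π/4, arctan( μ^{1/4} r / (8 c₀ R^{3/4}) ) }. Then there exists a constant C > 0, depending only on c₀, such that for every φ ∈ [π/4, φ₀], H̃(μ, φ) ≤ C · max{ R^{5/2} r^{−1} μ^{−1/2}, R^{7/4} μ^{−1/4} }. -/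
/- STATEMENT 9:
Let c₀ ∈ (0,1] satisfy arctan(x²) ≤ x for all x ∈ (0,c₀]. For 0 < r < R and μ > 0 set
φ₀ = max{π/4, arctan(μ^{1/4} r / (8 c₀ R^{3/4}))}. Then there is C > 0, depending only
on c₀, such that for every φ ∈ [π/4, φ₀],
H̃(μ,φ) ≤ C · max{R^{5/2} r^{−1} μ^{−1/2}, R^{7/4} μ^{−1/4}}. -/

open Real

/-- Elementary splitting of a product kernel into two Cauchy kernels. -/
lemma inv_one_add_sq_mul_sq_le (y z : ℝ) :
    (1 + y ^ 2 * z ^ 2)⁻¹ ≤ (1 + y ^ 2)⁻¹ + (1 + z ^ 2)⁻¹ := by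
  have hy := sq_nonneg y
  have hz := sq_nonneg z
  have hyz := mul_nonneg hy hz
  rw [inv_add_inv (by positivity) (by positivity), inv_eq_one_div,
    div_le_div_iff₀ (by positivity) (by positivity)]
  nlinarith [mul_nonneg hy hyz, mul_nonneg hz hyz]

lemma continuous_inv_one_add_sq_affine (k d : ℝ) :
    Continuous fun x : ℝ => (1 + (k * x + d) ^ 2)⁻¹ :=
  Continuous.inv₀ (by fun_prop) fun _ => by positivity

lemma integral_inv_one_add_sq_affine_le {k : ℝ} (hk : 0 < k) (d a b : ℝ) :
    ∫ x in a..b, (1 + (k * x + d) ^ 2)⁻¹ ≤ π / k := by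
  rw [intervalIntegral.integral_comp_mul_add (fun y : ℝ => (1 + y ^ 2)⁻¹) hk.ne',
    integral_inv_one_add_sq, smul_eq_mul, div_eq_inv_mul]
  gcongr
  linarith [arctan_lt_pi_div_two (k * b + d), neg_pi_div_two_lt_arctan (k * a + d)]

/-- The Cauchy-type kernel with quartic phase `x² (t c - x s)²` has integral `O(k⁻¹)`,
uniformly in the position `t c / s` of the second zero. -/
lemma integral_inv_one_add_phase_le {k ν s : ℝ} (hk : 0 < k) (hs : 0 < s)
    (hν : k ^ 4 ≤ ν * s ^ 2) (t c : ℝ) {a b : ℝ} (hab : a ≤ b) :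
    ∫ x in a..b, (1 + ν * x ^ 2 * (t * c - x * s) ^ 2)⁻¹ ≤ 2 * π / k := by
  have hν0 : 0 ≤ ν := by
    by_contra! h
    nlinarith [pow_pos hk 4, pow_pos hs 2]
  have hcont : Continuous fun x : ℝ => (1 + ν * x ^ 2 * (t * c - x * s) ^ 2)⁻¹ :=
    Continuous.inv₀ (by fun_prop) fun _ => by positivity
  set d : ℝ := -(k * (t * c / s)) with hd
  have h0 := continuous_inv_one_add_sq_affine k 0
  have h1 := continuous_inv_one_add_sq_affine k d
  have hpt : ∀ x : ℝ, (1 + ν * x ^ 2 * (t * c - x * s) ^ 2)⁻¹ ≤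
      (1 + (k * x + 0) ^ 2)⁻¹ + (1 + (k * x + d) ^ 2)⁻¹ := by
    intro x
    refine le_trans ?_ (inv_one_add_sq_mul_sq_le _ _)
    have e1 : (k * x + 0) ^ 2 * (k * x + d) ^ 2 = k ^ 4 * (x ^ 2 * (x - t * c / s) ^ 2) := by
      rw [hd]; ring
    have e2 : ν * x ^ 2 * (t * c - x * s) ^ 2 = ν * s ^ 2 * (x ^ 2 * (x - t * c / s) ^ 2) := by
      field_simp; ring
    rw [e1, e2]
    gcongr
  calc ∫ x in a..b, (1 + ν * x ^ 2 * (t * c - x * s) ^ 2)⁻¹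
      ≤ ∫ x in a..b, ((1 + (k * x + 0) ^ 2)⁻¹ + (1 + (k * x + d) ^ 2)⁻¹) :=
        intervalIntegral.integral_mono_on hab (hcont.intervalIntegrable _ _)
          ((h0.add h1).intervalIntegrable _ _) fun x _ => hpt x
    _ = (∫ x in a..b, (1 + (k * x + 0) ^ 2)⁻¹) + ∫ x in a..b, (1 + (k * x + d) ^ 2)⁻¹ :=
        intervalIntegral.integral_add (h0.intervalIntegrable _ _) (h1.intervalIntegrable _ _)
    _ ≤ π / k + π / k :=
        add_le_add (integral_inv_one_add_sq_affine_le hk _ _ _)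
          (integral_inv_one_add_sq_affine_le hk _ _ _)
    _ = 2 * π / k := by ring

lemma intervalIntegral_swap_of_continuous {F : ℝ → ℝ → ℝ} (hF : Continuous F.uncurry)
    (a b c d : ℝ) :
    ∫ x in a..b, ∫ y in c..d, F x y = ∫ y in c..d, ∫ x in a..b, F x y :=
  MeasureTheory.intervalIntegral_intervalIntegral_swap <|
    (hF.continuousOn.integrableOn_compact (isCompact_uIcc.prod isCompact_uIcc)).mono_set
      (Set.prod_mono Set.uIoc_subset_uIcc Set.uIoc_subset_uIcc)

/-- For angles at least `π / 4`, `H̃` is bounded by `8π R^{7/4} μ^{-1/4}`. -/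
lemma Htilde_le {r R μ φ : ℝ} (hr : 0 < r) (hrR : r < R) (hμ : 0 < μ)
    (h1 : π / 4 ≤ φ) (h2 : φ ≤ π / 2) :
    Htilde r R μ φ ≤ 8 * π * (R ^ ((7:ℝ)/4) * μ ^ (-(1/4 : ℝ))) := by
  have hR : 0 < R := hr.trans hrR
  have hsin : √2 / 2 ≤ sin φ := by
    rw [← sin_pi_div_four]
    exact sin_le_sin_of_le_of_le_pi_div_two (by linarith [pi_pos]) h2 h1
  have hs : 0 < sin φ := lt_of_lt_of_le (by positivity) hsin
  have hs2 : 1 / 2 ≤ sin φ ^ 2 := by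
    calc (1:ℝ) / 2 = (√2 / 2) ^ 2 := by rw [div_pow, sq_sqrt (by norm_num)]; norm_num
      _ ≤ sin φ ^ 2 := by gcongr
  set k : ℝ := μ ^ ((1:ℝ)/4) / (2 * R ^ ((3:ℝ)/4)) with hk_def
  have hk : 0 < k := by positivity
  have hk4 : k ^ 4 = μ / (16 * R ^ 3) := by
    rw [hk_def, div_pow, mul_pow, ← rpow_mul_natCast hμ.le, ← rpow_mul_natCast hR.le]
    norm_num
  have hν : k ^ 4 ≤ μ / (8 * R ^ 3) * sin φ ^ 2 := by
    calc k ^ 4 = μ / (8 * R ^ 3) * (1 / 2) := by rw [hk4]; field_simp; norm_num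
      _ ≤ _ := by gcongr
  have hrw : Htilde r R μ φ = ∫ ξ₂ in (0:ℝ)..(2 * R), ∫ ξ₁ in (r / 2)..(2 * R),
      (1 + μ / (8 * R ^ 3) * ξ₂ ^ 2 * (ξ₁ * cos φ - ξ₂ * sin φ) ^ 2)⁻¹ := by
    simp only [Htilde, div_mul_eq_mul_div]
  have hF : Continuous (Function.uncurry fun ξ₂ ξ₁ : ℝ =>
      (1 + μ / (8 * R ^ 3) * ξ₂ ^ 2 * (ξ₁ * cos φ - ξ₂ * sin φ) ^ 2)⁻¹) :=
    Continuous.inv₀ (by fun_prop) fun _ => by positivity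
  rw [hrw, intervalIntegral_swap_of_continuous hF]
  calc _ ≤ ∫ _ in (r / 2)..(2 * R), 2 * π / k :=
        intervalIntegral.integral_mono_on (by linarith)
          ((intervalIntegral.continuous_parametric_intervalIntegral_of_continuous'
            (f := fun ξ₁ ξ₂ : ℝ =>
              (1 + μ / (8 * R ^ 3) * ξ₂ ^ 2 * (ξ₁ * cos φ - ξ₂ * sin φ) ^ 2)⁻¹)
            (hF.comp continuous_swap) _ _).intervalIntegrable _ _)
          (by simp) fun t _ => integral_inv_one_add_phase_le hk hs hν t _ (by positivity)
    _ = (2 * R - r / 2) * (2 * π / k) := by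
        rw [intervalIntegral.integral_const, smul_eq_mul]
    _ ≤ 2 * R * (2 * π / k) := by gcongr; linarith
    _ = 8 * π * (R ^ ((7:ℝ)/4) * μ ^ (-(1/4 : ℝ))) := by
        have hR74 : R ^ ((7:ℝ)/4) = R * R ^ ((3:ℝ)/4) := by
          rw [← rpow_one_add' hR.le (by norm_num)]; norm_num
        rw [hR74, rpow_neg hμ.le, hk_def]
        field_simp
        norm_num

theorem Htilde_phi_intermediate_bound
    (c₀ : ℝ) (hc₀ : c₀ ∈ Set.Ioc (0:ℝ) 1)
    (hc₀' : ∀ x ∈ Set.Ioc (0:ℝ) c₀, Real.arctan (x ^ 2) ≤ x) :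
    ∃ C > 0, ∀ r R μ φ : ℝ, 0 < r → r < R → 0 < μ →
      φ ∈ Set.Icc (π / 4) (max (π / 4)
            (Real.arctan (μ ^ ((1:ℝ)/4) * r / (8 * c₀ * R ^ ((3:ℝ)/4))))) →
      Htilde r R μ φ ≤
        C * max (R ^ ((5:ℝ)/2) * r⁻¹ * μ ^ (-(1/2 : ℝ))) (R ^ ((7:ℝ)/4) * μ ^ (-(1/4 : ℝ))) := by
  refine ⟨8 * π, by positivity, fun r R μ φ hr hrR hμ hφ => ?_⟩
  have h2 : φ ≤ π / 2 :=
    hφ.2.trans (max_le (by linarith [pi_pos]) (arctan_lt_pi_div_two _).le)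
  exact (Htilde_le hr hrR hμ hφ.1 h2).trans
    (mul_le_mul_of_nonneg_left (le_max_right _ _) (by positivity))
end

section
/- Let α ∈ (0,1), ν > 0, and let θ̄₀ ∈ H^{3/2−α}(ℝ). Let θ̄(t) be the solution of the 1D fractional heat equation ∂_t θ̄ + ν |D|^α θ̄ = 0 with θ̄(0) = θ̄₀, i.e. the function with Fourier transform e^{−ν t |ξ|^α} θ̄̂₀(ξ). Then there exists a constant C > 0, depending only on α, such that ∫₀^∞ ‖∂_x θ̄(t)‖²_{L^{2/α}(ℝ)} dt ≤ C ν^{−1} ‖θ̄₀‖²_{H^{3/2−α}(ℝ)}. -/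
/- STATEMENT 14:
Let α ∈ (0,1), ν > 0 and θ̄₀ ∈ H^{3/2−α}(ℝ) (formalized here for Schwartz data, with
the inhomogeneous Sobolev norm written on the Fourier side). Let θ̄(t) be the solution
of ∂_t θ̄ + ν|D|^α θ̄ = 0, θ̄(0) = θ̄₀, i.e. the function with Fourier transform
e^{−νt|ξ|^α} θ̂₀(ξ). Then there is C > 0 depending only on α such that
∫₀^∞ ‖∂_x θ̄(t)‖²_{L^{2/α}(ℝ)} dt ≤ C ν^{−1} ‖θ̄₀‖²_{H^{3/2−α}(ℝ)}. -/

open MeasureTheory Real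
open scoped ENNReal

noncomputable section

/-- 1D Fourier transform `ĝ(ξ) = ∫ e^{−ixξ} g(x) dx`. -/
def FT1 (g : ℝ → ℂ) (ξ : ℝ) : ℂ := ∫ x : ℝ, Complex.exp (-Complex.I * (x * ξ : ℝ)) * g x

/-- 1D inverse Fourier transform. -/
def IFT1 (g : ℝ → ℂ) (x : ℝ) : ℂ := (2 * π)⁻¹ • ∫ ξ : ℝ, Complex.exp (Complex.I * (x * ξ : ℝ)) * g ξ

/-- The solution of the 1D fractional heat equation `∂_t θ̄ + ν |D|^α θ̄ = 0`. -/
def fracHeat (ν α : ℝ) (θ₀ : ℝ → ℂ) (t : ℝ) : ℝ → ℂ :=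
  IFT1 fun ξ => (Real.exp (-(ν * t * |ξ| ^ α)) : ℝ) • FT1 θ₀ ξ

open FourierTransform in
/-- The `L²` Fourier transform agrees almost everywhere with the Fourier integral on `L¹ ∩ L²`. -/
theorem coeFn_fourier_toLp_ae_eq {g : ℝ → ℂ} (hg : Integrable g) (hg2 : MemLp g 2) :
    (𝓕 (hg2.toLp g) : Lp ℂ 2 (volume : Measure ℝ)) =ᵐ[volume] 𝓕 g := by
  have hcont : Continuous (𝓕 g) :=
    VectorFourier.fourierIntegral_continuous Real.continuous_fourierChar
      (by exact continuous_inner) hg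
  refine ae_eq_of_integral_contDiff_smul_eq
    ((Lp.memLp _).locallyIntegrable (by norm_num)) hcont.locallyIntegrable ?_
  intro φ hφ hφc
  have hφ₁ : HasCompactSupport (Complex.ofRealCLM ∘ φ) := hφc.comp_left rfl
  have hφ₂ : ContDiff ℝ (⊤ : ℕ∞) (Complex.ofRealCLM ∘ φ) := by fun_prop
  set Φ : SchwartzMap ℝ ℂ := hφ₁.toSchwartzMap hφ₂
  have hΦ : ∀ x, Φ x = (φ x : ℂ) := fun x => rfl
  have h := congrArg (fun T => T Φ) (Lp.fourier_toTemperedDistribution_eq (hg2.toLp g))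
  simp only [TemperedDistribution.fourier_apply, Lp.toTemperedDistribution_apply] at h
  have hself : ∫ x, (𝓕 (Φ : ℝ → ℂ)) x • g x = ∫ x, Φ x • 𝓕 g x := by
    have := VectorFourier.integral_fourierIntegral_smul_eq_flip (L := innerₗ ℝ)
      (μ := volume) (ν := volume) Real.continuous_fourierChar
      (by exact continuous_inner) Φ.integrable hg
    rw [flip_innerₗ] at this
    exact this
  calc ∫ x, φ x • (𝓕 (hg2.toLp g) : Lp ℂ 2 (volume : Measure ℝ)) x
      = ∫ x, Φ x • (𝓕 (hg2.toLp g) : Lp ℂ 2 (volume : Measure ℝ)) x := by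
        simp [hΦ]
    _ = ∫ x, (𝓕 Φ) x • (hg2.toLp g) x := h.symm
    _ = ∫ x, (𝓕 (Φ : ℝ → ℂ)) x • g x := by
        refine integral_congr_ae ?_
        filter_upwards [hg2.coeFn_toLp] with x hx
        rw [hx, SchwartzMap.fourier_coe]
    _ = ∫ x, φ x • 𝓕 g x := by
        rw [hself]
        simp [hΦ]

open FourierTransform in
/-- Plancherel's theorem for the Fourier integral on `L¹ ∩ L²`. -/
theorem eLpNorm_two_fourier {g : ℝ → ℂ} (hg : Integrable g) (hg2 : MemLp g 2) :
    eLpNorm (𝓕 g) 2 volume = eLpNorm g 2 volume := by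
  rw [← eLpNorm_congr_ae (coeFn_fourier_toLp_ae_eq hg hg2), ← Lp.enorm_def,
    ← Lp.enorm_toLp (f := g) (hf := hg2)]
  simp only [← ofReal_norm, Lp.norm_fourier_eq]

theorem lintegral_enorm_sq_eq_eLpNorm_sq (f : ℝ → ℂ) :
    ∫⁻ x, ‖f x‖ₑ ^ 2 = eLpNorm f 2 volume ^ 2 := by
  have h := eLpNorm_nnreal_pow_eq_lintegral (f := f) (μ := volume) (p := 2) (by norm_num)
  simpa using h.symm

open FourierTransform in
theorem IFT1_eq_fourier (g : ℝ → ℂ) (x : ℝ) :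
    IFT1 g x = (2 * π)⁻¹ • 𝓕 g (-(2 * π)⁻¹ * x) := by
  rw [IFT1, Real.fourier_real_eq_integral_exp_smul]
  congr 2 with ξ
  rw [smul_eq_mul]
  congr 2
  have : -2 * π * ξ * (-(2 * π)⁻¹ * x) = x * ξ := by
    field_simp
  rw [this, mul_comm]

open FourierTransform in
theorem FT1_eq_fourier (g : ℝ → ℂ) (ξ : ℝ) :
    FT1 g ξ = 𝓕 g ((2 * π)⁻¹ * ξ) := by
  rw [FT1, Real.fourier_real_eq_integral_exp_smul]
  congr 1 with x
  rw [smul_eq_mul]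
  congr 2
  have : -2 * π * x * ((2 * π)⁻¹ * ξ) = -(x * ξ) := by
    field_simp
  rw [this]
  push_cast
  ring

theorem continuous_IFT1 {g : ℝ → ℂ} (hg : Integrable g) : Continuous (IFT1 g) := by
  have hcont : Continuous (FourierTransform.fourier g : ℝ → ℂ) :=
    VectorFourier.fourierIntegral_continuous Real.continuous_fourierChar
      (by exact continuous_inner) hg
  rw [funext (IFT1_eq_fourier g)]
  fun_prop

theorem two_pi_inv_le_one : (2 * π)⁻¹ ≤ 1 :=
  inv_le_one_of_one_le₀ (by linarith [Real.pi_gt_three])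

theorem lintegral_enorm_sq_IFT1_le {g : ℝ → ℂ} (hg : Integrable g) (hg2 : MemLp g 2) :
    ∫⁻ x, ‖IFT1 g x‖ₑ ^ 2 ≤ ∫⁻ ξ, ‖g ξ‖ₑ ^ 2 := by
  have hscale : ∫⁻ x, ‖(FourierTransform.fourier g : ℝ → ℂ) (-(2 * π)⁻¹ * x)‖ₑ ^ 2
      = ENNReal.ofReal (2 * π) * ∫⁻ ξ, ‖g ξ‖ₑ ^ 2 := by
    have hc : -(2 * π)⁻¹ ≠ 0 := by simp [Real.pi_ne_zero]
    have hme : MeasurableEmbedding (fun x : ℝ => -(2 * π)⁻¹ * x) :=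
      (Homeomorph.mulLeft₀ _ hc).measurableEmbedding
    rw [← hme.lintegral_map (fun y => ‖(FourierTransform.fourier g : ℝ → ℂ) y‖ₑ ^ 2),
      Real.map_volume_mul_left hc, lintegral_smul_measure, lintegral_enorm_sq_eq_eLpNorm_sq,
      eLpNorm_two_fourier hg hg2, lintegral_enorm_sq_eq_eLpNorm_sq]
    simp [abs_of_pos Real.pi_pos]
  simp_rw [IFT1_eq_fourier, enorm_smul, mul_pow]
  rw [lintegral_const_mul' _ _ (ENNReal.pow_ne_top enorm_ne_top), hscale, ← mul_assoc]
  refine mul_le_of_le_one_left zero_le ?_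
  rw [Real.enorm_eq_ofReal (by positivity), ← ENNReal.ofReal_pow (by positivity),
    ← ENNReal.ofReal_mul (by positivity)]
  refine ENNReal.ofReal_le_one.2 ?_
  have : (2 * π)⁻¹ ^ 2 * (2 * π) = (2 * π)⁻¹ := by field_simp
  rw [this]
  exact two_pi_inv_le_one

theorem enorm_IFT1_le (g : ℝ → ℂ) (x : ℝ) : ‖IFT1 g x‖ₑ ≤ ∫⁻ ξ, ‖g ξ‖ₑ := by
  rw [IFT1, enorm_smul]
  refine (mul_le_of_le_one_left zero_le ?_).trans ((enorm_integral_le_lintegral_enorm _).trans ?_)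
  · rw [Real.enorm_eq_ofReal (by positivity)]
    exact ENNReal.ofReal_le_one.2 two_pi_inv_le_one
  · refine lintegral_mono fun ξ => ?_
    rw [enorm_mul, ← ofReal_norm, mul_comm Complex.I, Complex.norm_exp_ofReal_mul_I]
    simp

theorem integrable_exp_mul {g : ℝ → ℂ} (hg : Integrable g) (x : ℝ) :
    Integrable fun ξ : ℝ => Complex.exp (Complex.I * (x * ξ : ℝ)) * g ξ := by
  refine hg.bdd_mul (c := 1) (by fun_prop) (ae_of_all _ fun ξ => ?_)
  rw [mul_comm Complex.I, Complex.norm_exp_ofReal_mul_I]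

theorem IFT1_add {g h : ℝ → ℂ} (hg : Integrable g) (hh : Integrable h) (x : ℝ) :
    IFT1 (g + h) x = IFT1 g x + IFT1 h x := by
  simp only [IFT1, Pi.add_apply, mul_add]
  rw [integral_add (integrable_exp_mul hg x) (integrable_exp_mul hh x), smul_add]

theorem deriv_IFT1 {g : ℝ → ℂ} (hg : Integrable g) (hg' : Integrable fun ξ : ℝ => ξ • g ξ) :
    deriv (IFT1 g) = IFT1 fun ξ => Complex.I * (ξ • g ξ) := by
  ext x
  have h := Real.hasDerivAt_fourier hg hg' (-(2 * π)⁻¹ * x)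
  have hlin : HasDerivAt (fun x : ℝ => -(2 * π)⁻¹ * x) (-(2 * π)⁻¹) x := by
    simpa using (hasDerivAt_id x).const_mul (-(2 * π)⁻¹)
  have h2 := (h.scomp x hlin).const_smul (2 * π)⁻¹
  rw [funext (IFT1_eq_fourier g)]
  refine h2.deriv.trans ?_
  rw [IFT1_eq_fourier]
  congr 1
  simp only [Real.fourier_real_eq_integral_exp_smul]
  rw [← integral_smul]
  congr 1 with ξ
  have hpi : (π : ℂ) ≠ 0 := by simp [Real.pi_ne_zero]
  simp only [smul_eq_mul, Complex.real_smul]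
  push_cast
  field_simp

theorem lintegral_Ioc_rpow {p b : ℝ} (hp : -1 < p) (hb : 0 ≤ b) :
    ∫⁻ x in Set.Ioc 0 b, ENNReal.ofReal (x ^ p) = ENNReal.ofReal (b ^ (p + 1) / (p + 1)) := by
  have hint : IntegrableOn (fun x : ℝ => x ^ p) (Set.Ioc 0 b) :=
    (intervalIntegrable_iff_integrableOn_Ioc_of_le hb).1
      (intervalIntegral.intervalIntegrable_rpow' hp)
  rw [← ofReal_integral_eq_lintegral_ofReal hint, ← intervalIntegral.integral_of_le hb,
    integral_rpow (Or.inl hp), Real.zero_rpow (by linarith), sub_zero]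
  filter_upwards [ae_restrict_mem measurableSet_Ioc] with x hx
  exact Real.rpow_nonneg hx.1.le p

theorem lintegral_abs_lt_rpow_le {p r : ℝ} (hp : -1 < p) (hr : 0 ≤ r) :
    ∫⁻ x in {x : ℝ | |x| < r}, ENNReal.ofReal (|x| ^ p)
      ≤ ENNReal.ofReal (2 / (p + 1) * r ^ (p + 1)) := by
  have hpos : ∫⁻ x in Set.Ioc 0 r, ENNReal.ofReal (|x| ^ p)
      = ENNReal.ofReal (r ^ (p + 1) / (p + 1)) := by
    rw [← lintegral_Ioc_rpow hp hr]
    refine setLIntegral_congr_fun measurableSet_Ioc fun x hx => ?_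
    simp only [abs_of_pos hx.1]
  have hneg : ∫⁻ x in Neg.neg ⁻¹' Set.Ioc 0 r, ENNReal.ofReal (|x| ^ p)
      = ENNReal.ofReal (r ^ (p + 1) / (p + 1)) := by
    have h := (Measure.measurePreserving_neg (volume : Measure ℝ)).setLIntegral_comp_preimage_emb
      (Homeomorph.neg ℝ).measurableEmbedding (fun x => ENNReal.ofReal (|x| ^ p)) (Set.Ioc 0 r)
    simp only [abs_neg] at h
    rw [h, hpos]
  have hzero : ∫⁻ x in {(0 : ℝ)}, ENNReal.ofReal (|x| ^ p) = 0 := by simp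
  have hsub : {x : ℝ | |x| < r} ⊆ (Set.Ioc 0 r ∪ Neg.neg ⁻¹' Set.Ioc 0 r) ∪ {0} := by
    intro x hx
    obtain ⟨h1, h2⟩ := abs_lt.1 (show |x| < r from hx)
    rcases lt_trichotomy x 0 with h | h | h
    · exact Or.inl (Or.inr ⟨by linarith, by linarith⟩)
    · exact Or.inr h
    · exact Or.inl (Or.inl ⟨h, h2.le⟩)
  calc ∫⁻ x in {x : ℝ | |x| < r}, ENNReal.ofReal (|x| ^ p)
      ≤ ∫⁻ x in (Set.Ioc 0 r ∪ Neg.neg ⁻¹' Set.Ioc 0 r) ∪ {0}, ENNReal.ofReal (|x| ^ p) :=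
        lintegral_mono_set hsub
    _ ≤ (ENNReal.ofReal (r ^ (p + 1) / (p + 1)) + ENNReal.ofReal (r ^ (p + 1) / (p + 1))) + 0 := by
        refine (lintegral_union_le _ _ _).trans (add_le_add ?_ hzero.le)
        exact (lintegral_union_le _ _ _).trans (add_le_add hpos.le hneg.le)
    _ = ENNReal.ofReal (2 / (p + 1) * r ^ (p + 1)) := by
        have : 0 < p + 1 := by linarith
        rw [add_zero, ← ENNReal.ofReal_add (by positivity) (by positivity)]
        congr 1
        ring

/-- The squared homogeneous Sobolev norm `∫ |ξ|^{2s} |g(ξ)|² dξ` on the Fourier side. -/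
def homSobolevSq (s : ℝ) (g : ℝ → ℂ) : ℝ≥0∞ :=
  ∫⁻ ξ, ‖g ξ‖ₑ ^ 2 * ENNReal.ofReal (|ξ| ^ (2 * s))

theorem lintegral_low_frequency_le {α : ℝ} (hα0 : 0 < α) {g : ℝ → ℂ}
    (hg : AEStronglyMeasurable g) {n l : ℝ} (hn : 0 < n) (hl : 0 < l)
    (hE : homSobolevSq ((1 - α) / 2) g ≤ ENNReal.ofReal (n ^ 2)) :
    ∫⁻ ξ in {ξ : ℝ | 2 * √(2 / α) * n * |ξ| ^ (α / 2) < l}, ‖g ξ‖ₑ ≤ ENNReal.ofReal (l / 2) := by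
  set M := 2 * √(2 / α) * n with hM
  have hMpos : 0 < M := by positivity
  set S := {ξ : ℝ | M * |ξ| ^ (α / 2) < l} with hS
  have hsub : S ⊆ {ξ : ℝ | |ξ| < (l / M) ^ (2 / α)} := by
    intro ξ hξ
    have h1 : |ξ| ^ (α / 2) < l / M := by
      rw [lt_div_iff₀ hMpos, mul_comm]
      exact hξ
    have h2 := Real.rpow_lt_rpow (by positivity) h1 (by positivity : 0 < 2 / α)
    rwa [← Real.rpow_mul (abs_nonneg _), show α / 2 * (2 / α) = 1 by field_simp,
      Real.rpow_one] at h2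
  have hweight : ∫⁻ ξ in S, ENNReal.ofReal (|ξ| ^ (-(1 - α) / 2)) ^ (2 : ℝ)
      ≤ ENNReal.ofReal (2 / α * (l / M) ^ 2) := by
    calc ∫⁻ ξ in S, ENNReal.ofReal (|ξ| ^ (-(1 - α) / 2)) ^ (2 : ℝ)
        = ∫⁻ ξ in S, ENNReal.ofReal (|ξ| ^ (α - 1)) := by
          refine lintegral_congr fun ξ => ?_
          rw [ENNReal.ofReal_rpow_of_nonneg (by positivity) (by norm_num),
            ← Real.rpow_mul (abs_nonneg _)]
          congr 2
          ring
      _ ≤ ∫⁻ ξ in {ξ : ℝ | |ξ| < (l / M) ^ (2 / α)}, ENNReal.ofReal (|ξ| ^ (α - 1)) :=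
          lintegral_mono_set hsub
      _ ≤ _ := lintegral_abs_lt_rpow_le (by linarith) (by positivity)
      _ = _ := by
          rw [sub_add_cancel, ← Real.rpow_mul (by positivity),
            show 2 / α * α = ((2 : ℕ) : ℝ) by field_simp; norm_num, Real.rpow_natCast]
  have henergy : ∫⁻ ξ in S, (‖g ξ‖ₑ * ENNReal.ofReal (|ξ| ^ ((1 - α) / 2))) ^ (2 : ℝ)
      ≤ ENNReal.ofReal (n ^ 2) := by
    refine le_trans ?_ hE
    refine (setLIntegral_le_lintegral _ _).trans_eq (lintegral_congr fun ξ => ?_)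
    rw [ENNReal.mul_rpow_of_nonneg _ _ (by norm_num),
      ENNReal.ofReal_rpow_of_nonneg (by positivity) (by norm_num), ← Real.rpow_mul (abs_nonneg _),
      mul_comm ((1 - α) / 2)]
    simp
  have hholder := ENNReal.lintegral_mul_le_Lp_mul_Lq (volume.restrict S) Real.HolderConjugate.two_two
    (f := fun ξ => ‖g ξ‖ₑ * ENNReal.ofReal (|ξ| ^ ((1 - α) / 2)))
    (g := fun ξ => ENNReal.ofReal (|ξ| ^ (-(1 - α) / 2)))
    (hg.enorm.restrict.mul (by fun_prop)) (by fun_prop)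
  calc ∫⁻ ξ in S, ‖g ξ‖ₑ
      ≤ ∫⁻ ξ in S, ((fun ξ => ‖g ξ‖ₑ * ENNReal.ofReal (|ξ| ^ ((1 - α) / 2))) *
          (fun ξ => ENNReal.ofReal (|ξ| ^ (-(1 - α) / 2)))) ξ := by
        refine lintegral_mono_ae (ae_restrict_of_ae ?_)
        filter_upwards [Measure.ae_ne volume (0 : ℝ)] with ξ hξ
        have hξ' : 0 < |ξ| := abs_pos.2 hξ
        rw [Pi.mul_apply, mul_assoc, ← ENNReal.ofReal_mul (by positivity),
          ← Real.rpow_add hξ', show (1 - α) / 2 + -(1 - α) / 2 = 0 by ring, Real.rpow_zero]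
        simp
    _ ≤ _ := hholder
    _ ≤ ENNReal.ofReal (n ^ 2) ^ (1 / 2 : ℝ) *
          ENNReal.ofReal (2 / α * (l / M) ^ 2) ^ (1 / 2 : ℝ) := by
        gcongr
    _ = ENNReal.ofReal (l / 2) := by
        rw [ENNReal.ofReal_rpow_of_nonneg (by positivity) (by norm_num),
          ENNReal.ofReal_rpow_of_nonneg (by positivity) (by norm_num),
          ← ENNReal.ofReal_mul (by positivity), ← Real.sqrt_eq_rpow, ← Real.sqrt_eq_rpow,
          Real.sqrt_mul (by positivity), Real.sqrt_sq hn.le, Real.sqrt_sq (by positivity)]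
        congr 1
        rw [hM]
        have : 0 < √(2 / α) := by positivity
        field_simp

theorem measure_superlevel_IFT1_le {α : ℝ} (hα0 : 0 < α) {g : ℝ → ℂ}
    (hg : Integrable g) (hg2 : MemLp g 2) {n l : ℝ} (hn : 0 < n) (hl : 0 < l)
    (hE : homSobolevSq ((1 - α) / 2) g ≤ ENNReal.ofReal (n ^ 2)) :
    volume {x : ℝ | l < ‖IFT1 g x‖} ≤ ENNReal.ofReal (4 * l ^ (-2 : ℝ)) *
      ∫⁻ ξ in {ξ : ℝ | l ≤ 2 * √(2 / α) * n * |ξ| ^ (α / 2)}, ‖g ξ‖ₑ ^ 2 := by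
  set S := {ξ : ℝ | l ≤ 2 * √(2 / α) * n * |ξ| ^ (α / 2)} with hS
  have hSm : MeasurableSet S := measurableSet_le (by fun_prop) (by fun_prop)
  have hlow := lintegral_low_frequency_le hα0 hg.1 hn hl hE
  have hSc : {ξ : ℝ | 2 * √(2 / α) * n * |ξ| ^ (α / 2) < l} = Sᶜ := by
    ext ξ
    simp [hS]
  rw [hSc] at hlow
  have hsplit : ∀ x, IFT1 g x = IFT1 (S.indicator g) x + IFT1 (Sᶜ.indicator g) x := by
    intro x
    rw [← IFT1_add (hg.indicator hSm) (hg.indicator hSm.compl), Set.indicator_self_add_compl]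
  have hlow' : ∀ x, ‖IFT1 (Sᶜ.indicator g) x‖ₑ ≤ ENNReal.ofReal (l / 2) := by
    intro x
    refine (enorm_IFT1_le _ x).trans (le_trans (le_of_eq ?_) hlow)
    rw [← lintegral_indicator hSm.compl]
    simp only [enorm_indicator_eq_indicator_enorm]
  have hsub : {x : ℝ | l < ‖IFT1 g x‖} ⊆
      {x | ENNReal.ofReal (l / 2) ^ 2 ≤ ‖IFT1 (S.indicator g) x‖ₑ ^ 2} := by
    intro x hx
    have h1 : ‖IFT1 (Sᶜ.indicator g) x‖ ≤ l / 2 := by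
      have := hlow' x
      rwa [← ofReal_norm, ENNReal.ofReal_le_ofReal_iff (by positivity)] at this
    have h2 := norm_add_le (IFT1 (S.indicator g) x) (IFT1 (Sᶜ.indicator g) x)
    rw [← hsplit x] at h2
    have hx' : l < ‖IFT1 g x‖ := hx
    have h3 : l / 2 ≤ ‖IFT1 (S.indicator g) x‖ := by linarith
    show ENNReal.ofReal (l / 2) ^ 2 ≤ ‖IFT1 (S.indicator g) x‖ₑ ^ 2
    rw [← ofReal_norm]
    gcongr
  have hcont := continuous_IFT1 (hg.indicator hSm)
  have hcheb := meas_ge_le_lintegral_div (μ := volume)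
    (f := fun x => ‖IFT1 (S.indicator g) x‖ₑ ^ 2) (by fun_prop)
    (ε := ENNReal.ofReal (l / 2) ^ 2) (by simp [hl]) (by simp)
  refine (measure_mono hsub).trans (hcheb.trans ?_)
  have hconst : (ENNReal.ofReal (l / 2) ^ 2)⁻¹ = ENNReal.ofReal (4 * l ^ (-2 : ℝ)) := by
    rw [← ENNReal.ofReal_pow (by positivity), ← ENNReal.ofReal_inv_of_pos (by positivity),
      Real.rpow_neg hl.le, Real.rpow_ofNat]
    congr 1
    field_simp
    norm_num
  rw [ENNReal.div_eq_inv_mul, hconst]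
  refine mul_le_mul_right ?_ _
  refine (lintegral_enorm_sq_IFT1_le (hg.indicator hSm) (hg2.indicator hSm)).trans_eq ?_
  rw [← lintegral_indicator hSm]
  refine lintegral_congr fun ξ => ?_
  by_cases h : ξ ∈ S <;> simp [h]

theorem lintegral_rpow_IFT1_le {α : ℝ} (hα0 : 0 < α) (hα1 : α < 1) {g : ℝ → ℂ}
    (hg : Integrable g) (hg2 : MemLp g 2) {n : ℝ} (hn : 0 < n)
    (hE : homSobolevSq ((1 - α) / 2) g ≤ ENNReal.ofReal (n ^ 2)) :
    ∫⁻ x, ENNReal.ofReal (‖IFT1 g x‖ ^ (2 / α)) ≤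
      ENNReal.ofReal (2 / α * (4 * (2 * √(2 / α)) ^ (2 / α - 2) / (2 / α - 2)) * n ^ (2 / α)) := by
  set q := 2 / α with hq
  have hq2 : 2 < q := by
    rw [hq, lt_div_iff₀ hα0]
    linarith
  set M := 2 * √q * n with hM
  have hMpos : 0 < M := by positivity
  set T := {p : ℝ × ℝ | p.1 ≤ M * |p.2| ^ (α / 2)} with hT
  have hTm : MeasurableSet T := measurableSet_le (by fun_prop) (by fun_prop)
  set F : ℝ → ℝ → ℝ≥0∞ := fun l ξ =>
    T.indicator (fun p => ‖g p.2‖ₑ ^ 2 * ENNReal.ofReal (4 * p.1 ^ (q - 3))) (l, ξ) with hF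
  have hFm : AEMeasurable (Function.uncurry F)
      ((volume.restrict (Set.Ioi (0 : ℝ))).prod (volume : Measure ℝ)) := by
    have h1 : AEMeasurable (fun p : ℝ × ℝ => ‖g p.2‖ₑ)
        ((volume.restrict (Set.Ioi (0 : ℝ))).prod (volume : Measure ℝ)) := hg.1.comp_snd.enorm
    exact ((h1.pow_const 2).mul (by fun_prop)).indicator hTm
  have hlevel : ∀ l ∈ Set.Ioi (0 : ℝ),
      volume {x : ℝ | l < ‖IFT1 g x‖} * ENNReal.ofReal (l ^ (q - 1)) ≤ ∫⁻ ξ, F l ξ := by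
    intro l hl
    have hl' : (0 : ℝ) < l := hl
    have hSm : MeasurableSet {ξ : ℝ | l ≤ M * |ξ| ^ (α / 2)} :=
      measurableSet_le (by fun_prop) (by fun_prop)
    have hFl : ∫⁻ ξ, F l ξ = (∫⁻ ξ in {ξ : ℝ | l ≤ M * |ξ| ^ (α / 2)}, ‖g ξ‖ₑ ^ 2) *
        ENNReal.ofReal (4 * l ^ (q - 3)) := by
      rw [← lintegral_mul_const' _ _ ENNReal.ofReal_ne_top, ← lintegral_indicator hSm]
      rfl
    rw [hFl]
    refine (mul_le_mul_left (measure_superlevel_IFT1_le hα0 hg hg2 hn hl' hE) _).trans_eq ?_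
    rw [mul_comm (ENNReal.ofReal _), mul_assoc, ← ENNReal.ofReal_mul (by positivity),
      mul_assoc 4, ← Real.rpow_add hl', show -2 + (q - 1) = q - 3 by ring]
  have hinner : ∀ ξ, ∫⁻ l in Set.Ioi (0 : ℝ), F l ξ =
      ENNReal.ofReal (4 * M ^ (q - 2) / (q - 2)) *
        (‖g ξ‖ₑ ^ 2 * ENNReal.ofReal (|ξ| ^ (2 * ((1 - α) / 2)))) := by
    intro ξ
    set b := M * |ξ| ^ (α / 2) with hb
    have hb0 : 0 ≤ b := by positivity
    calc ∫⁻ l in Set.Ioi (0 : ℝ), F l ξ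
        = ∫⁻ l in Set.Ioc 0 b, ‖g ξ‖ₑ ^ 2 * ENNReal.ofReal (4 * l ^ (q - 3)) := by
          have : ∀ l, F l ξ = (Set.Iic b).indicator
              (fun l => ‖g ξ‖ₑ ^ 2 * ENNReal.ofReal (4 * l ^ (q - 3))) l := fun l => rfl
          simp only [this]
          rw [lintegral_indicator measurableSet_Iic, Measure.restrict_restrict measurableSet_Iic,
            Set.inter_comm, Set.Ioi_inter_Iic]
      _ = ‖g ξ‖ₑ ^ 2 * (ENNReal.ofReal 4 * ENNReal.ofReal (b ^ (q - 2) / (q - 2))) := by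
          simp only [ENNReal.ofReal_mul (show (0 : ℝ) ≤ 4 by norm_num)]
          rw [lintegral_const_mul' _ _ (ENNReal.pow_ne_top enorm_ne_top),
            lintegral_const_mul' _ _ ENNReal.ofReal_ne_top,
            lintegral_Ioc_rpow (by linarith) hb0, show q - 3 + 1 = q - 2 by ring]
      _ = _ := by
          have hexp : α / 2 * (q - 2) = 2 * ((1 - α) / 2) := by
            rw [hq]
            field_simp
          rw [mul_left_comm (ENNReal.ofReal (4 * M ^ (q - 2) / (q - 2))),
            ← ENNReal.ofReal_mul (by norm_num),
            ← ENNReal.ofReal_mul (div_nonneg (by positivity) (by linarith)), hb,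
            Real.mul_rpow hMpos.le (by positivity), ← Real.rpow_mul (abs_nonneg _), hexp]
          congr 2
          ring
  rw [lintegral_rpow_eq_lintegral_meas_lt_mul volume (ae_of_all _ fun x => norm_nonneg _)
    (continuous_IFT1 hg).norm.aemeasurable (by linarith)]
  calc ENNReal.ofReal q *
        ∫⁻ l in Set.Ioi 0, volume {x : ℝ | l < ‖IFT1 g x‖} * ENNReal.ofReal (l ^ (q - 1))
      ≤ ENNReal.ofReal q * ∫⁻ l in Set.Ioi 0, ∫⁻ ξ, F l ξ := by
        gcongr 1
        exact setLIntegral_mono' measurableSet_Ioi hlevel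
    _ = ENNReal.ofReal q * (ENNReal.ofReal (4 * M ^ (q - 2) / (q - 2)) *
          homSobolevSq ((1 - α) / 2) g) := by
        rw [lintegral_lintegral_swap hFm]
        simp only [hinner]
        rw [lintegral_const_mul' _ _ ENNReal.ofReal_ne_top]
        rfl
    _ ≤ ENNReal.ofReal q * (ENNReal.ofReal (4 * M ^ (q - 2) / (q - 2)) *
          ENNReal.ofReal (n ^ 2)) := by gcongr
    _ = _ := by
        have hq0 : 0 < q - 2 := by linarith
        rw [← ENNReal.ofReal_mul (by positivity), ← ENNReal.ofReal_mul (by positivity), hM,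
          Real.mul_rpow (by positivity) hn.le]
        congr 1
        have : n ^ q = n ^ (q - 2) * n ^ 2 := by
          rw [← Real.rpow_natCast n 2, ← Real.rpow_add hn]
          norm_num
        rw [this]
        ring

/-- The Sobolev embedding `Ḣ^{(1-α)/2}(ℝ) ↪ L^{2/α}(ℝ)`, on the Fourier side. -/
theorem exists_eLpNorm_IFT1_sq_le {α : ℝ} (hα0 : 0 < α) (hα1 : α < 1) :
    ∃ K : ℝ, 0 < K ∧ ∀ g : ℝ → ℂ, Integrable g → MemLp g 2 →
      eLpNorm (IFT1 g) (ENNReal.ofReal (2 / α)) volume ^ 2 ≤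
        ENNReal.ofReal K * homSobolevSq ((1 - α) / 2) g := by
  set q := 2 / α with hq
  have hq2 : 2 < q := by
    rw [hq, lt_div_iff₀ hα0]
    linarith
  have hq0 : 0 < q - 2 := by linarith
  set K₀ := q * (4 * (2 * √q) ^ (q - 2) / (q - 2)) with hK₀
  have hK₀pos : 0 < K₀ := by positivity
  set K := (K₀ ^ (1 / q)) ^ 2 with hK
  have hKpos : 0 < K := by positivity
  refine ⟨K, hKpos, fun g hg hg2 => ?_⟩
  have hbound : ∀ n : ℝ, 0 < n → homSobolevSq ((1 - α) / 2) g ≤ ENNReal.ofReal (n ^ 2) →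
      eLpNorm (IFT1 g) (ENNReal.ofReal q) volume ^ 2 ≤ ENNReal.ofReal K * ENNReal.ofReal (n ^ 2) := by
    intro n hn hE
    have h := lintegral_rpow_IFT1_le hα0 hα1 hg hg2 hn hE
    have hnorm : eLpNorm (IFT1 g) (ENNReal.ofReal q) volume ≤
        ENNReal.ofReal (K₀ ^ (1 / q) * n) := by
      rw [eLpNorm_eq_lintegral_rpow_enorm_toReal (by simp; linarith) (by simp),
        ENNReal.toReal_ofReal (by linarith)]
      have hpow : ∀ x, ‖IFT1 g x‖ₑ ^ q = ENNReal.ofReal (‖IFT1 g x‖ ^ q) := by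
        intro x
        rw [← ofReal_norm, ENNReal.ofReal_rpow_of_nonneg (by positivity) (by linarith)]
      simp only [hpow]
      refine (ENNReal.rpow_le_rpow h (by positivity)).trans_eq ?_
      rw [ENNReal.ofReal_rpow_of_nonneg (by positivity) (by positivity),
        Real.mul_rpow hK₀pos.le (by positivity), ← Real.rpow_mul hn.le,
        mul_one_div_cancel (by linarith), Real.rpow_one]
    refine (pow_le_pow_left₀ zero_le hnorm 2).trans_eq ?_
    rw [← ENNReal.ofReal_pow (by positivity), ← ENNReal.ofReal_mul hKpos.le, mul_pow]
  refine ENNReal.le_of_forall_pos_le_add fun ε hε hfin => ?_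
  have hEfin : homSobolevSq ((1 - α) / 2) g ≠ ∞ := by
    intro htop
    rw [htop, ENNReal.mul_top (by simpa using hKpos)] at hfin
    exact lt_irrefl _ hfin
  set e := (homSobolevSq ((1 - α) / 2) g).toReal with he
  have he0 : 0 ≤ e := ENNReal.toReal_nonneg
  have hε' : (0 : ℝ) < ε := hε
  have hpos : 0 < e + ε / K := by positivity
  have hsq : √(e + ε / K) ^ 2 = e + ε / K := Real.sq_sqrt hpos.le
  have hEe : homSobolevSq ((1 - α) / 2) g = ENNReal.ofReal e := (ENNReal.ofReal_toReal hEfin).symm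
  refine (hbound (√(e + ε / K)) (by positivity) ?_).trans_eq ?_
  · rw [hsq, hEe]
    exact ENNReal.ofReal_le_ofReal (le_add_of_nonneg_right (by positivity))
  · rw [hsq, hEe, ← ENNReal.ofReal_mul hKpos.le, ← ENNReal.ofReal_mul hKpos.le, mul_add,
      mul_div_cancel₀ _ hKpos.ne', ENNReal.ofReal_add (by positivity) (by positivity),
      ENNReal.ofReal_coe_nnreal]

/-- The Fourier transform of a real Schwartz function is a Schwartz function. -/
theorem exists_schwartzMap_eq_FT1 (θ : SchwartzMap ℝ ℝ) :
    ∃ H : SchwartzMap ℝ ℂ, ∀ ξ, FT1 (fun x => ((θ x : ℝ) : ℂ)) ξ = H ξ := by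
  have hc : (2 * π)⁻¹ ≠ 0 := by simp [Real.pi_ne_zero]
  refine ⟨SchwartzMap.compCLMOfContinuousLinearEquiv ℝ
    (ContinuousLinearEquiv.unitsEquivAut ℝ (Units.mk0 (2 * π)⁻¹ hc))
    (FourierTransform.fourier (θ.postcompCLM Complex.ofRealCLM)), fun ξ => ?_⟩
  rw [FT1_eq_fourier, SchwartzMap.compCLMOfContinuousLinearEquiv_apply, Function.comp_apply,
    SchwartzMap.fourier_coe, ContinuousLinearEquiv.unitsEquivAut_apply, Units.val_mk0, mul_comm]
  rfl

theorem integrable_sobolev_weight_mul (H : SchwartzMap ℝ ℂ) {s : ℝ} (hs : s ≤ 2) :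
    Integrable fun ξ : ℝ => (1 + ξ ^ 2) ^ s * ‖H ξ‖ ^ 2 := by
  obtain ⟨C, hC0, hC⟩ := H.decay 0 0
  have hbound : Integrable fun ξ : ℝ =>
      C * (‖ξ‖ ^ 0 * ‖H ξ‖ + 2 * (‖ξ‖ ^ 2 * ‖H ξ‖) + ‖ξ‖ ^ 4 * ‖H ξ‖) :=
    (((H.integrable_pow_mul volume 0).add ((H.integrable_pow_mul volume 2).const_mul 2)).add
      (H.integrable_pow_mul volume 4)).const_mul C
  have hmeas : Continuous fun ξ : ℝ => (1 + ξ ^ 2) ^ s * ‖H ξ‖ ^ 2 := by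
    refine Continuous.mul ?_ (H.continuous.norm.pow 2)
    exact Continuous.rpow_const (by fun_prop) fun ξ => Or.inl (by positivity)
  refine hbound.mono' hmeas.aestronglyMeasurable (ae_of_all _ fun ξ => ?_)
  have h1 : (1 + ξ ^ 2) ^ s ≤ (1 + ξ ^ 2) ^ 2 := by
    rw [← Real.rpow_natCast (1 + ξ ^ 2) 2]
    exact Real.rpow_le_rpow_of_exponent_le (by nlinarith [sq_nonneg ξ]) (by simpa using hs)
  have h2 : ‖H ξ‖ ≤ C := by simpa using hC ξ
  rw [Real.norm_of_nonneg (by positivity)]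
  calc (1 + ξ ^ 2) ^ s * ‖H ξ‖ ^ 2 ≤ (1 + ξ ^ 2) ^ 2 * (C * ‖H ξ‖) := by
        rw [pow_two ‖H ξ‖]
        gcongr
    _ = _ := by
        rw [Real.norm_eq_abs, show |ξ| ^ 4 = (|ξ| ^ 2) ^ 2 by ring, sq_abs]
        ring

theorem abs_rpow_le_one_add_sq_rpow {α ξ : ℝ} (hα1 : α < 1) :
    |ξ| ^ (3 - 2 * α) ≤ (1 + ξ ^ 2) ^ ((3 : ℝ) / 2 - α) := by
  calc |ξ| ^ (3 - 2 * α) = (ξ ^ 2) ^ ((3 : ℝ) / 2 - α) := by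
        rw [← sq_abs, ← Real.rpow_natCast, ← Real.rpow_mul (abs_nonneg _)]
        congr 1
        push_cast
        ring
    _ ≤ _ := Real.rpow_le_rpow (by positivity) (by linarith) (by linarith)

/-- The Fourier-side energy identity in time, as an upper bound at a fixed frequency. -/
theorem lintegral_heat_weight_le {α ν : ℝ} (hα1 : α < 1) (hν : 0 < ν) {ξ : ℝ} (hξ : ξ ≠ 0) :
    ∫⁻ t in Set.Ioi (0 : ℝ),
        ENNReal.ofReal (Real.exp (-(ν * t * |ξ| ^ α)) ^ 2 * |ξ| ^ (3 - α)) ≤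
      ENNReal.ofReal (ν⁻¹ * (1 + ξ ^ 2) ^ ((3 : ℝ) / 2 - α)) := by
  have hξ' : 0 < |ξ| := abs_pos.2 hξ
  set a := -(2 * ν * |ξ| ^ α) with ha
  have ha0 : a < 0 := by
    rw [ha, neg_lt_zero]
    positivity
  have hexp : ∀ t, Real.exp (-(ν * t * |ξ| ^ α)) ^ 2 = Real.exp (a * t) := by
    intro t
    rw [← Real.exp_nat_mul]
    congr 1
    rw [ha]
    push_cast
    ring
  simp only [hexp]
  rw [← ofReal_integral_eq_lintegral_ofReal ((integrableOn_exp_mul_Ioi ha0 0).mul_const _)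
    (ae_of_all _ fun t => by positivity), integral_mul_const, integral_exp_mul_Ioi ha0]
  refine ENNReal.ofReal_le_ofReal ?_
  have hsplit : |ξ| ^ (3 - α) = |ξ| ^ (3 - 2 * α) * |ξ| ^ α := by
    rw [← Real.rpow_add hξ']
    congr 1
    ring
  have hval : -Real.exp (a * 0) / a * |ξ| ^ (3 - α) = (2 * ν)⁻¹ * |ξ| ^ (3 - 2 * α) := by
    have : 0 < |ξ| ^ α := by positivity
    rw [hsplit, ha, mul_zero, Real.exp_zero]
    field_simp
  rw [hval]
  refine mul_le_mul ?_ (abs_rpow_le_one_add_sq_rpow hα1) (by positivity) (by positivity)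
  exact inv_anti₀ hν (by linarith)

/-- Sobolev's inequality for the spatial derivative of the heat flow, at a fixed time. -/
theorem eLpNorm_deriv_IFT1_heat_sq_le {α ν t K : ℝ} (hν : 0 < ν) (ht : 0 < t)
    (hK : ∀ g : ℝ → ℂ, Integrable g → MemLp g 2 →
      eLpNorm (IFT1 g) (ENNReal.ofReal (2 / α)) volume ^ 2 ≤
        ENNReal.ofReal K * homSobolevSq ((1 - α) / 2) g) (H : SchwartzMap ℝ ℂ) :
    eLpNorm (deriv (IFT1 fun ξ => Real.exp (-(ν * t * |ξ| ^ α)) • H ξ))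
        (ENNReal.ofReal (2 / α)) volume ^ 2 ≤
      ENNReal.ofReal K * ∫⁻ ξ, ‖H ξ‖ₑ ^ 2 *
        ENNReal.ofReal (Real.exp (-(ν * t * |ξ| ^ α)) ^ 2 * |ξ| ^ (3 - α)) := by
  set P : SchwartzMap ℝ ℂ := SchwartzMap.smulLeftCLM ℂ (fun ξ : ℝ => ξ) H with hP
  have hPapp : ∀ ξ, P ξ = ξ • H ξ := fun ξ =>
    SchwartzMap.smulLeftCLM_apply_apply (by fun_prop) H ξ
  have hexpm : Measurable fun ξ : ℝ => Real.exp (-(ν * t * |ξ| ^ α)) := by fun_prop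
  have hexple : ∀ ξ : ℝ, ‖Real.exp (-(ν * t * |ξ| ^ α))‖ ≤ 1 := by
    intro ξ
    rw [Real.norm_of_nonneg (by positivity), Real.exp_le_one_iff, neg_nonpos]
    positivity
  have hg : Integrable fun ξ => Real.exp (-(ν * t * |ξ| ^ α)) • H ξ :=
    H.integrable.bdd_smul 1 hexpm.aestronglyMeasurable (ae_of_all _ hexple)
  have hg' : Integrable fun ξ : ℝ => ξ • Real.exp (-(ν * t * |ξ| ^ α)) • H ξ := by
    have := P.integrable.bdd_smul 1 hexpm.aestronglyMeasurable (ae_of_all volume hexple)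
    refine this.congr (ae_of_all _ fun ξ => ?_)
    simp only [Pi.smul_apply', hPapp]
    exact smul_comm _ _ _
  rw [deriv_IFT1 hg hg']
  have hmem : MemLp (fun ξ : ℝ => Complex.I * (ξ • Real.exp (-(ν * t * |ξ| ^ α)) • H ξ)) 2 := by
    refine (P.memLp 2).of_le (hg'.1.const_mul _) (ae_of_all _ fun ξ => ?_)
    rw [smul_comm, ← hPapp, norm_mul, Complex.norm_I, one_mul, norm_smul]
    exact mul_le_of_le_one_left (norm_nonneg _) (hexple ξ)
  refine (hK _ (hg'.const_mul _) hmem).trans (mul_le_mul_right (le_of_eq ?_) _)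
  refine lintegral_congr_ae ?_
  filter_upwards [Measure.ae_ne volume (0 : ℝ)] with ξ hξ
  have hξ' : 0 < |ξ| := abs_pos.2 hξ
  have hnorm : ‖Complex.I * (ξ • Real.exp (-(ν * t * |ξ| ^ α)) • H ξ)‖ₑ =
      ‖H ξ‖ₑ * ENNReal.ofReal (|ξ| * Real.exp (-(ν * t * |ξ| ^ α))) := by
    rw [← ofReal_norm, ← ofReal_norm, ← ENNReal.ofReal_mul (norm_nonneg _), norm_mul,
      Complex.norm_I, norm_smul, norm_smul, Real.norm_of_nonneg (Real.exp_nonneg _),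
      Real.norm_eq_abs]
    congr 1
    ring
  rw [hnorm, mul_pow, mul_assoc, ← ENNReal.ofReal_pow (by positivity),
    ← ENNReal.ofReal_mul (by positivity)]
  congr 2
  have : |ξ| ^ (3 - α) = |ξ| ^ 2 * |ξ| ^ (2 * ((1 - α) / 2)) := by
    rw [← Real.rpow_natCast |ξ| 2, ← Real.rpow_add hξ']
    congr 1
    push_cast
    ring
  rw [this]
  ring

theorem fracHeat_deriv_L2t_Lq_estimate (α : ℝ) (hα0 : 0 < α) (hα1 : α < 1) :
    ∃ C > 0, ∀ ν > 0, ∀ θ₀ : SchwartzMap ℝ ℝ,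
      (∫⁻ t in Set.Ioi (0:ℝ),
          (eLpNorm (deriv (fracHeat ν α (fun x => ((θ₀ x : ℝ) : ℂ)) t))
            (ENNReal.ofReal (2 / α)) volume) ^ 2)
        ≤ ENNReal.ofReal (C * ν⁻¹ *
            ∫ ξ : ℝ, (1 + ξ ^ 2) ^ ((3:ℝ)/2 - α) * ‖FT1 (fun x => ((θ₀ x : ℝ) : ℂ)) ξ‖ ^ 2) := by
  obtain ⟨K, hKpos, hK⟩ := exists_eLpNorm_IFT1_sq_le hα0 hα1
  refine ⟨K, hKpos, fun ν hν θ₀ => ?_⟩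
  obtain ⟨H, hH⟩ := exists_schwartzMap_eq_FT1 θ₀
  simp only [fracHeat, hH]
  set w : ℝ → ℝ → ℝ := fun t ξ => Real.exp (-(ν * t * |ξ| ^ α)) ^ 2 * |ξ| ^ (3 - α) with hw
  have hmeas : Measurable (Function.uncurry fun t ξ => ‖H ξ‖ₑ ^ 2 * ENNReal.ofReal (w t ξ)) := by
    have : Measurable H := H.continuous.measurable
    simp only [hw]
    fun_prop
  calc ∫⁻ t in Set.Ioi (0 : ℝ),
        eLpNorm (deriv (IFT1 fun ξ => Real.exp (-(ν * t * |ξ| ^ α)) • H ξ))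
          (ENNReal.ofReal (2 / α)) volume ^ 2
      ≤ ∫⁻ t in Set.Ioi (0 : ℝ),
          ENNReal.ofReal K * ∫⁻ ξ, ‖H ξ‖ₑ ^ 2 * ENNReal.ofReal (w t ξ) :=
        setLIntegral_mono' measurableSet_Ioi fun t ht =>
          eLpNorm_deriv_IFT1_heat_sq_le hν ht hK H
    _ = ENNReal.ofReal K * ∫⁻ ξ, ‖H ξ‖ₑ ^ 2 *
          ∫⁻ t in Set.Ioi (0 : ℝ), ENNReal.ofReal (w t ξ) := by
        rw [lintegral_const_mul' _ _ ENNReal.ofReal_ne_top,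
          lintegral_lintegral_swap hmeas.aemeasurable]
        simp only [lintegral_const_mul' _ _ (ENNReal.pow_ne_top (enorm_ne_top (x := H _)))]
    _ ≤ ENNReal.ofReal K * ∫⁻ ξ, ENNReal.ofReal ν⁻¹ *
          ENNReal.ofReal ((1 + ξ ^ 2) ^ ((3 : ℝ) / 2 - α) * ‖H ξ‖ ^ 2) := by
        refine mul_le_mul_right (lintegral_mono_ae ?_) _
        filter_upwards [Measure.ae_ne volume (0 : ℝ)] with ξ hξ
        refine (mul_le_mul_right (lintegral_heat_weight_le hα1 hν hξ) _).trans_eq ?_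
        rw [← ofReal_norm, ← ENNReal.ofReal_pow (norm_nonneg _),
          ← ENNReal.ofReal_mul (by positivity), ← ENNReal.ofReal_mul (by positivity)]
        congr 1
        ring
    _ = _ := by
        rw [lintegral_const_mul' _ _ ENNReal.ofReal_ne_top,
          ← ofReal_integral_eq_lintegral_ofReal (integrable_sobolev_weight_mul H (by linarith))
            (ae_of_all _ fun ξ => by positivity), ← mul_assoc, ← ENNReal.ofReal_mul hKpos.le,
          ← ENNReal.ofReal_mul (by positivity)]

end
end
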